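/- Strict concavity of the surrogate objective (Lemma 3): Let H be an N×M complex matrix with full column rank (rank H = M), R an N×N Hermitian positive definite complex matrix, and D an arbitrary M×M complex matrix. The function Ũ(Q) := Re Tr( H Q H^H (H Q H^H + R)^{-1} ) + Re Tr( D^H Q ) is strictly concave on the convex set of M×M Hermitian positive semidefinite complex matrices. -/

import Mathlib

open Matrix ComplexOrder

open scoped MatrixOrder Matrix.Norms.L2Operator in
lemma Matrix.PosDef.exists_isUnit_eq_conjTranspose_mul_self {n : Type*} [Fintype n] [DecidableEq n]
    {A : Matrix n n ℂ} (hA : A.PosDef) : ∃ B : Matrix n n ℂ, IsUnit B ∧ A = Bᴴ * B := by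
  obtain ⟨B, hB⟩ := CStarAlgebra.nonneg_iff_eq_star_mul_self.mp hA.posSemidef.nonneg
  refine ⟨B, ?_, hB⟩
  have hu := hA.isUnit
  rw [isUnit_iff_isUnit_det] at hu ⊢
  rw [hB, det_mul] at hu
  exact isUnit_of_mul_isUnit_right hu

lemma Matrix.PosDef.trace_mul_mul_mul_conjTranspose_pos {m n : Type*} [Fintype m] [DecidableEq m]
    [Fintype n] [DecidableEq n] {R : Matrix m m ℂ} (hR : R.PosDef) {A : Matrix n n ℂ}
    (hA : A.PosDef) {K : Matrix m n ℂ} (hK : K ≠ 0) : 0 < (R * (K * A * Kᴴ)).trace := by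
  obtain ⟨T, hT, rfl⟩ := hR.exists_isUnit_eq_conjTranspose_mul_self
  obtain ⟨S, hS, rfl⟩ := hA.exists_isUnit_eq_conjTranspose_mul_self
  have hW : (Tᴴ * T * (K * (Sᴴ * S) * Kᴴ)).trace
      = ((S * Kᴴ * Tᴴ)ᴴ * (S * Kᴴ * Tᴴ)).trace := by
    rw [Matrix.mul_assoc Tᴴ, trace_mul_comm]
    simp [Matrix.mul_assoc]
  rw [hW]
  refine (posSemidef_conjTranspose_mul_self _).trace_nonneg.lt_of_ne' fun h ↦ hK ?_
  rw [trace_conjTranspose_mul_self_eq_zero_iff] at h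
  rw [isUnit_iff_isUnit_det] at hS
  have hT' : IsUnit Tᴴ.det := by rw [← isUnit_iff_isUnit_det]; exact hT.star
  rw [← conjTranspose_eq_zero, ← nonsing_inv_mul_cancel_left S Kᴴ hS,
    ← mul_nonsing_inv_cancel_right Tᴴ (S * Kᴴ) hT', h]
  simp

/-- Quantitative form of the operator convexity of the matrix inverse. -/
lemma Matrix.smul_inv_add_smul_inv_sub_inv {n : Type*} [Fintype n] [DecidableEq n]
    {A B : Matrix n n ℂ} (hA : IsUnit A) (hB : IsUnit B) {a b : ℝ} (hab : a + b = 1)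
    (hC : IsUnit (a • A + b • B)) :
    a • A⁻¹ + b • B⁻¹ - (a • A + b • B)⁻¹
      = a • (((a • A + b • B)⁻¹ * A - 1) * A⁻¹ * (A * (a • A + b • B)⁻¹ - 1))
        + b • (((a • A + b • B)⁻¹ * B - 1) * B⁻¹ * (B * (a • A + b • B)⁻¹ - 1)) := by
  generalize hCdef : a • A + b • B = C at *
  rw [isUnit_iff_isUnit_det] at hA hB hC
  have expand (X : Matrix n n ℂ) (hX : IsUnit X.det) :
      (C⁻¹ * X - 1) * X⁻¹ * (X * C⁻¹ - 1) = C⁻¹ * X * C⁻¹ - C⁻¹ - C⁻¹ + X⁻¹ := by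
    have h1 : (C⁻¹ * X - 1) * X⁻¹ = C⁻¹ - X⁻¹ := by
      rw [sub_mul, one_mul, mul_nonsing_inv_cancel_right _ _ hX]
    rw [h1, sub_mul, mul_sub, mul_sub, nonsing_inv_mul_cancel_left _ _ hX, mul_one, mul_one,
      Matrix.mul_assoc]
    abel
  have hsum : a • (C⁻¹ * A * C⁻¹) + b • (C⁻¹ * B * C⁻¹) = C⁻¹ := by
    have : a • (C⁻¹ * A * C⁻¹) + b • (C⁻¹ * B * C⁻¹) = C⁻¹ * (a • A + b • B) * C⁻¹ := by
      simp [mul_add, add_mul]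
    rw [this, hCdef, nonsing_inv_mul _ hC, one_mul]
  have hone : C⁻¹ = a • C⁻¹ + b • C⁻¹ := by rw [← add_smul, hab, one_smul]
  rw [expand A hA, expand B hB]
  simp only [smul_add, smul_sub]
  linear_combination (norm := module) (-1 : ℝ) • hsum + (-2 : ℝ) • hone

/-- `A ↦ Re Tr (R A⁻¹)` is strictly convex on positive definite matrices. -/
lemma Matrix.PosDef.strictConvexOn_re_trace_mul_inv {n : Type*} [Fintype n] [DecidableEq n]
    {R : Matrix n n ℂ} (hR : R.PosDef) :
    StrictConvexOn ℝ {A : Matrix n n ℂ | A.PosDef} (fun A ↦ (R * A⁻¹).trace.re) := by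
  have hconv {A B : Matrix n n ℂ} (hA : A.PosDef) (hB : B.PosDef) {a b : ℝ} (ha : 0 < a)
      (hb : 0 < b) : (a • A + b • B).PosDef := (hA.smul ha).add (hB.smul hb)
  refine ⟨convex_iff_forall_pos.2 fun A hA B hB a b ha hb _ ↦ hconv hA hB ha hb, ?_⟩
  intro A hA B hB hne a b ha hb hab
  have hC := hconv hA hB ha hb
  have key := smul_inv_add_smul_inv_sub_inv hA.isUnit hB.isUnit hab hC.isUnit
  have pos (X : Matrix n n ℂ) (hX : X.PosDef) (hXC : X ≠ a • A + b • B) :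
      0 < (R * (((a • A + b • B)⁻¹ * X - 1) * X⁻¹ * (X * (a • A + b • B)⁻¹ - 1))).trace.re := by
    have hK : (a • A + b • B)⁻¹ * X - 1 ≠ 0 := fun h ↦ hXC <| by
      rw [← mul_nonsing_inv_cancel_left (a • A + b • B) X
        ((isUnit_iff_isUnit_det _).1 hC.isUnit), sub_eq_zero.1 h, mul_one]
    have h := hR.trace_mul_mul_mul_conjTranspose_pos hX.inv hK
    rw [conjTranspose_sub, conjTranspose_mul, hC.inv.isHermitian.eq, hX.isHermitian.eq,
      conjTranspose_one] at h
    exact (Complex.pos_iff.1 h).1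
  have hAC : A ≠ a • A + b • B := fun h ↦ hne <| by
    have : b • (A - B) = 0 := by linear_combination (norm := module) h + hab • A
    exact sub_eq_zero.1 ((smul_eq_zero.1 this).resolve_left hb.ne')
  have hBC : B ≠ a • A + b • B := fun h ↦ hne <| by
    have : a • (A - B) = 0 := by linear_combination (norm := module) -h - hab • B
    exact sub_eq_zero.1 ((smul_eq_zero.1 this).resolve_left ha.ne')
  have hre := congrArg (fun X ↦ (R * X).trace.re) key
  rw [Matrix.mul_sub, Matrix.mul_add, Matrix.mul_add] at hre
  simp only [mul_smul_comm, trace_add, trace_sub, trace_smul, Complex.add_re, Complex.sub_re,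
    Complex.smul_re, smul_eq_mul] at hre
  have hA' := mul_pos ha (pos A hA hAC)
  have hB' := mul_pos hb (pos B hB hBC)
  simp only [smul_eq_mul]
  linarith

lemma Matrix.mul_left_cancel_of_rank_eq_card {m n p : Type*} [Fintype m] [Fintype n] [DecidableEq n]
    {H : Matrix m n ℂ} (hH : H.rank = Fintype.card n) {X Y : Matrix n p ℂ} (h : H * X = H * Y) :
    X = Y := by
  have hu : IsUnit (Hᴴ * H) := by
    rw [← linearIndependent_cols_iff_isUnit, linearIndependent_iff_card_eq_finrank_span,
      ← hH, ← rank_conjTranspose_mul_self, rank_eq_finrank_span_cols]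
    rfl
  rw [isUnit_iff_isUnit_det] at hu
  rw [← nonsing_inv_mul_cancel_left _ X hu, Matrix.mul_assoc, h, ← Matrix.mul_assoc Hᴴ,
    nonsing_inv_mul_cancel_left _ Y hu]

/-- Strict concavity of the surrogate objective (Lemma 3): if `H` has full column rank,
then `Ũ(Q) = Re Tr(H Q Hᴴ (H Q Hᴴ + R)⁻¹) + Re Tr(Dᴴ Q)` is strictly concave on the
set of PSD matrices. -/
theorem surrogate_objective_strictly_concave {N M : ℕ} (H : Matrix (Fin N) (Fin M) ℂ)
    (hH : H.rank = M) (R : Matrix (Fin N) (Fin N) ℂ) (hR : R.PosDef)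
    (D : Matrix (Fin M) (Fin M) ℂ) :
    StrictConcaveOn ℝ {Q : Matrix (Fin M) (Fin M) ℂ | Q.PosSemidef}
      (fun Q => ((H * Q * Hᴴ * (H * Q * Hᴴ + R)⁻¹).trace).re + ((Dᴴ * Q).trace).re) := by
  have hcard : H.rank = Fintype.card (Fin M) := by simpa using hH
  have hpd {Q : Matrix (Fin M) (Fin M) ℂ} (hQ : Q.PosSemidef) : (H * Q * Hᴴ + R).PosDef :=
    .posSemidef_add (hQ.mul_mul_conjTranspose_same H) hR
  have htr {Q : Matrix (Fin M) (Fin M) ℂ} (hQ : Q.PosSemidef) :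
      (H * Q * Hᴴ * (H * Q * Hᴴ + R)⁻¹).trace.re = N - (R * (H * Q * Hᴴ + R)⁻¹).trace.re := by
    have h := mul_nonsing_inv _ ((isUnit_iff_isUnit_det _).1 (hpd hQ).isUnit)
    rw [add_mul] at h
    rw [eq_sub_of_add_eq h]
    simp
  have hconv : Convex ℝ {Q : Matrix (Fin M) (Fin M) ℂ | Q.PosSemidef} :=
    fun x hx y hy a b ha hb _ ↦ (hx.smul ha).add (hy.smul hb)
  refine ⟨hconv, ?_⟩
  intro x hx y hy hne a b ha hb hab
  have hne' : H * x * Hᴴ + R ≠ H * y * Hᴴ + R := fun h ↦ hne <| by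
    have h1 := add_right_cancel h
    rw [Matrix.mul_assoc, Matrix.mul_assoc] at h1
    have h2 := congrArg conjTranspose (mul_left_cancel_of_rank_eq_card hcard h1)
    simp only [conjTranspose_mul, conjTranspose_conjTranspose] at h2
    exact conjTranspose_injective (mul_left_cancel_of_rank_eq_card hcard h2)
  have key := hR.strictConvexOn_re_trace_mul_inv.2 (hpd hx) (hpd hy) hne' ha hb hab
  have haff : a • (H * x * Hᴴ + R) + b • (H * y * Hᴴ + R) = H * (a • x + b • y) * Hᴴ + R := by
    have hR1 : R = a • R + b • R := by rw [← add_smul, hab, one_smul]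
    simp only [Matrix.mul_add, Matrix.add_mul, Matrix.mul_smul, Matrix.smul_mul]
    linear_combination (norm := module) -hR1
  rw [haff] at key
  beta_reduce
  rw [htr hx, htr hy, htr (hconv hx hy ha.le hb.le hab)]
  simp only [Matrix.mul_add, Matrix.mul_smul, trace_add, trace_smul, Complex.add_re, Complex.smul_re,
    smul_eq_mul] at key ⊢
  linear_combination key + (N : ℝ) * hab
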